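/- Let J⁰ be the osculating structure on ℂⁿ with antisymmetric coefficients A_{ᾱβ̄}. For z, u, w ∈ ℂⁿ define T_z(u,w) := −(D_w J⁰)_z(u) + (D_u J⁰)_z(w) + J⁰_z((D_{J⁰_z w} J⁰)_z(u) − (D_{J⁰_z u} J⁰)_z(w)), where (D_w J⁰)_z denotes the directional derivative of z ↦ J⁰_z in the direction w. Then T_z(u,w) = 0 for all z, u, w ∈ ℂⁿ. Moreover, the endomorphism field 𝕁⁰ on ℂⁿ×ℂⁿ defined by 𝕁⁰_{(z,P)}(u,q) = (J⁰_z(u), i·q + Σ_{α}(Σ_β A_{ᾱβ̄} z̄^β)·conj(qₙ)·e_α) satisfies 𝕁⁰ ∘ 𝕁⁰ = −Id at every point, and the projection π(z,P) = z intertwines the structures: dπ ∘ 𝕁⁰_{(z,P)} = J⁰_z ∘ dπ. -/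

import Mathlib

open Complex ComplexConjugate Finset

noncomputable section

/-- Standard complex structure of `ℂⁿ`: multiplication by `i`. -/
def Jstd (n : ℕ) : (Fin n → ℂ) →L[ℝ] (Fin n → ℂ) :=
  Complex.I • ContinuousLinearMap.id ℝ (Fin n → ℂ)

/-- The functional `v ↦ Σ_{α,β} A_{ᾱβ̄} z̄^β conj(v^α)` used in the osculating structure. -/
def oscCoeff (n : ℕ) (A : Fin n → Fin n → ℂ) (z : Fin (n+1) → ℂ) :
    (Fin (n+1) → ℂ) →L[ℝ] ℂ :=
  ∑ α : Fin n, ∑ β : Fin n,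
    (A α β * conj (z β.castSucc)) •
      (Complex.conjCLE.toContinuousLinearMap.comp
        (ContinuousLinearMap.proj α.castSucc : (Fin (n+1) → ℂ) →L[ℝ] ℂ))

/-- The osculating almost complex structure `J⁰` on `ℂ^{n+1}` with coefficients `A`. -/
def Josc (n : ℕ) (A : Fin n → Fin n → ℂ) (z : Fin (n+1) → ℂ) :
    (Fin (n+1) → ℂ) →L[ℝ] (Fin (n+1) → ℂ) :=
  Jstd (n+1) + (oscCoeff n A z).smulRight (Pi.single (Fin.last n) 1)

/-- The fibre part of the lifted structure:
`q ↦ Σ_α (Σ_β A_{ᾱβ̄} z̄^β)·conj(qₙ)·e_α`. -/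
def liftCoeff (n : ℕ) (A : Fin n → Fin n → ℂ) (z : Fin (n+1) → ℂ) :
    (Fin (n+1) → ℂ) →L[ℝ] (Fin (n+1) → ℂ) :=
  ∑ α : Fin n,
    (∑ β : Fin n, A α β * conj (z β.castSucc)) •
      ((Complex.conjCLE.toContinuousLinearMap.comp
        (ContinuousLinearMap.proj (Fin.last n) : (Fin (n+1) → ℂ) →L[ℝ] ℂ)).smulRight
          (Pi.single α.castSucc 1))

/-- The lifted almost complex structure `𝕁⁰` on `ℂ^{n+1} × ℂ^{n+1} ≅ T*ℂ^{n+1}`: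
`𝕁⁰_{(z,P)}(u,q) = (J⁰_z(u), i·q + Σ_α (Σ_β A_{ᾱβ̄} z̄^β)·conj(qₙ)·e_α)`. -/
def Jlift (n : ℕ) (A : Fin n → Fin n → ℂ)
    (zP : (Fin (n+1) → ℂ) × (Fin (n+1) → ℂ)) :
    ((Fin (n+1) → ℂ) × (Fin (n+1) → ℂ)) →L[ℝ] ((Fin (n+1) → ℂ) × (Fin (n+1) → ℂ)) :=
  ((Josc n A zP.1).comp
    (ContinuousLinearMap.fst ℝ (Fin (n+1) → ℂ) (Fin (n+1) → ℂ))).prod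
  ((Jstd (n+1) + liftCoeff n A zP.1).comp
    (ContinuousLinearMap.snd ℝ (Fin (n+1) → ℂ) (Fin (n+1) → ℂ)))

theorem oscCoeff_apply (n : ℕ) (A : Fin n → Fin n → ℂ) (z v : Fin (n+1) → ℂ) :
    oscCoeff n A z v =
      ∑ α : Fin n, ∑ β : Fin n, A α β * conj (z β.castSucc) * conj (v α.castSucc) := by
  simp [oscCoeff]

theorem Josc_apply (n : ℕ) (A : Fin n → Fin n → ℂ) (z v : Fin (n+1) → ℂ) :
    Josc n A z v = Complex.I • v + oscCoeff n A z v • Pi.single (Fin.last n) 1 := by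
  simp [Josc, Jstd]

theorem Josc_apply_castSucc (n : ℕ) (A : Fin n → Fin n → ℂ) (z v : Fin (n+1) → ℂ) (α : Fin n) :
    Josc n A z v α.castSucc = Complex.I * v α.castSucc := by
  simp [Josc_apply]

theorem oscCoeff_Josc_right (n : ℕ) (A : Fin n → Fin n → ℂ) (z p v : Fin (n+1) → ℂ) :
    oscCoeff n A z (Josc n A p v) = -Complex.I * oscCoeff n A z v := by
  simp only [oscCoeff_apply, Josc_apply_castSucc, mul_sum, map_mul, conj_I]
  exact sum_congr rfl fun α _ => sum_congr rfl fun β _ => by ring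

theorem oscCoeff_Josc_left (n : ℕ) (A : Fin n → Fin n → ℂ) (p z v : Fin (n+1) → ℂ) :
    oscCoeff n A (Josc n A p z) v = -Complex.I * oscCoeff n A z v := by
  simp only [oscCoeff_apply, Josc_apply_castSucc, mul_sum, map_mul, conj_I]
  exact sum_congr rfl fun α _ => sum_congr rfl fun β _ => by ring

/-- The part of `Josc` that is real-linear in the base point. -/
def oscLinear (n : ℕ) (A : Fin n → Fin n → ℂ) :
    (Fin (n+1) → ℂ) →ₗ[ℝ] (Fin (n+1) → ℂ) →L[ℝ] (Fin (n+1) → ℂ) where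
  toFun z := (oscCoeff n A z).smulRight (Pi.single (Fin.last n) 1)
  map_add' z w := by
    ext1 v
    simp [oscCoeff_apply, mul_add, add_mul, sum_add_distrib, add_smul]
  map_smul' c z := by
    ext1 v
    simp only [ContinuousLinearMap.smulRight_apply, smul_apply,
      RingHom.id_apply, ← smul_assoc]
    congr 1
    simp only [oscCoeff_apply, smul_sum, Pi.smul_apply, real_smul, map_mul, conj_ofReal]
    exact sum_congr rfl fun α _ => sum_congr rfl fun β _ => by ring

theorem fderiv_Josc_apply (n : ℕ) (A : Fin n → Fin n → ℂ) (z w u : Fin (n+1) → ℂ) :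
    fderiv ℝ (Josc n A) z w u = oscCoeff n A w u • Pi.single (Fin.last n) 1 := by
  have h : HasFDerivAt (Josc n A) (LinearMap.toContinuousLinearMap (oscLinear n A)) z :=
    (LinearMap.toContinuousLinearMap (oscLinear n A)).hasFDerivAt.const_add (Jstd (n+1))
  rw [h.fderiv]
  rfl

theorem Josc_Josc (n : ℕ) (A : Fin n → Fin n → ℂ) (z v : Fin (n+1) → ℂ) :
    Josc n A z (Josc n A z v) = -v := by
  rw [Josc_apply, oscCoeff_Josc_right, Josc_apply, smul_add, smul_smul, smul_smul, I_mul_I]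
  module

theorem Josc_smul_single_last (n : ℕ) (A : Fin n → Fin n → ℂ) (z : Fin (n+1) → ℂ) (c : ℂ) :
    Josc n A z (c • Pi.single (Fin.last n) 1) = (Complex.I * c) • Pi.single (Fin.last n) 1 := by
  simp [Josc_apply, oscCoeff_apply, smul_smul]

theorem liftCoeff_apply (n : ℕ) (A : Fin n → Fin n → ℂ) (z q : Fin (n+1) → ℂ) :
    liftCoeff n A z q = conj (q (Fin.last n)) •
      ∑ α : Fin n, (∑ β : Fin n, A α β * conj (z β.castSucc)) •
        (Pi.single α.castSucc 1 : Fin (n+1) → ℂ) := by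
  simp only [liftCoeff, _root_.sum_apply, smul_sum]
  refine sum_congr rfl fun α _ => ?_
  rw [smul_comm]
  simp

theorem liftCoeff_apply_last (n : ℕ) (A : Fin n → Fin n → ℂ) (z q : Fin (n+1) → ℂ) :
    liftCoeff n A z q (Fin.last n) = 0 := by
  simp [liftCoeff_apply, (Fin.castSucc_lt_last _).ne']

theorem Jstd_add_liftCoeff_sq (n : ℕ) (A : Fin n → Fin n → ℂ) (z q : Fin (n+1) → ℂ) :
    (Jstd (n+1) + liftCoeff n A z) ((Jstd (n+1) + liftCoeff n A z) q) = -q := by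
  have h (p : Fin (n+1) → ℂ) :
      (Jstd (n+1) + liftCoeff n A z) p = Complex.I • p + liftCoeff n A z p := by
    simp [Jstd]
  have hlast : (Complex.I • q + liftCoeff n A z q) (Fin.last n) =
      Complex.I * q (Fin.last n) := by
    simp [liftCoeff_apply_last]
  rw [h, h, liftCoeff_apply n A z (_ + _), hlast, map_mul, conj_I, mul_smul,
    ← liftCoeff_apply, smul_add, smul_smul, I_mul_I]
  module

/-- the tensor `T` built from the first derivatives of `J⁰` vanishes
identically; the lifted endomorphism field `𝕁⁰` squares to `−Id`, and the projection
`π(z,P) = z` intertwines `𝕁⁰` with `J⁰`. -/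
theorem stmt10 (n : ℕ) (hn : 1 ≤ n) (A : Fin n → Fin n → ℂ)
    (hA : ∀ α β, A α β = - A β α) :
    (∀ z u w : Fin (n+1) → ℂ,
      - (fderiv ℝ (Josc n A) z w) u + (fderiv ℝ (Josc n A) z u) w +
        Josc n A z
          ((fderiv ℝ (Josc n A) z (Josc n A z w)) u -
           (fderiv ℝ (Josc n A) z (Josc n A z u)) w) = 0) ∧
    (∀ (zP v : (Fin (n+1) → ℂ) × (Fin (n+1) → ℂ)),
      Jlift n A zP (Jlift n A zP v) = -v) ∧
    (∀ (zP v : (Fin (n+1) → ℂ) × (Fin (n+1) → ℂ)),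
      (Jlift n A zP v).1 = Josc n A zP.1 v.1) := by
  refine ⟨fun z u w => ?_, fun zP v => ?_, fun zP v => rfl⟩
  · simp only [fderiv_Josc_apply, oscCoeff_Josc_left, ← sub_smul, Josc_smul_single_last]
    rw [← mul_sub, ← mul_assoc, mul_neg, I_mul_I]
    module
  · exact Prod.ext (Josc_Josc n A zP.1 v.1) (Jstd_add_liftCoeff_sq n A zP.1 v.2)
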